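/- Let T : X → X be a Lipschitz self-map of the circle X = ℝ/ℤ which is a covering map of degree d with |d| ≥ 2, with a fixed point c, such that for every open neighborhood V of c there is C > 1 with |T'(x)| ≥ C for Lebesgue-a.e. x ∈ X \ V. Fix s ≥ 1 and let λ_s ∈ (0,1) be such that |T'| ≥ λ_s^{-1} a.e. outside the neighborhood V_s of c (bounded by the two preimage points of c under T^s adjacent to c). Then for any arc J in X and integers l, r ≥ 1: if T^l J ≠ X and #{0 ≤ k < l : T^k J ∩ V_s = ∅} ≥ r, then |J| ≤ λ_s^r · |T^l J|. -/

import Mathlib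

open MeasureTheory Set
open scoped Classical

lemma growth_aux (F : ℝ → ℝ) (KF : NNReal) (hF : LipschitzWith KF F) (hFmono : Monotone F)
    (C : ℝ) (A : Set ℝ) (hA : A.OrdConnected)
    (h : ∀ᵐ x : ℝ, x ∈ A → C ≤ |deriv F x|) {a b : ℝ} (ha : a ∈ A) (hb : b ∈ A)
    (hab : a ≤ b) : C * (b - a) ≤ F b - F a := by
  have hac : AbsolutelyContinuousOnInterval F a b :=
    (hF.lipschitzOnWith (s := uIcc a b)).absolutelyContinuousOnInterval
  rw [← hac.integral_deriv_eq_sub]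
  have h2 : ∫ _ in a..b, C = C * (b - a) := by
    simp [mul_comm]
  rw [← h2]
  refine intervalIntegral.integral_mono_ae_restrict hab (by simp)
    hac.intervalIntegrable_deriv ?_
  rw [Filter.EventuallyLE, ae_restrict_iff' measurableSet_Icc]
  filter_upwards [h] with x hx hxI
  have := hx (hA.out ha hb hxI)
  rwa [abs_of_nonneg hFmono.deriv_nonneg] at this

lemma volume_coe_image (a : ℝ) (A : Set ℝ) (hA : A.OrdConnected) (hAa : A ⊆ Ioo a (a + 1)) :
    volume ((fun x : ℝ => (x : UnitAddCircle)) '' A) = volume A := by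
  have hinj : InjOn (fun x : ℝ => (x : UnitAddCircle)) (Ioc a (a + 1)) := by
    intro x hx y hy hxy
    exact (AddCircle.coe_eq_coe_iff_of_mem_Ioc (p := (1 : ℝ)) (a := a) hx hy).1 hxy
  have hsub : A ⊆ Ioc a (a + 1) := hAa.trans Ioo_subset_Ioc_self
  have hm : MeasurableSet ((fun x : ℝ => (x : UnitAddCircle)) '' A) :=
    hA.measurableSet.image_of_continuousOn_injOn
      (AddCircle.continuous_mk' (1 : ℝ)).continuousOn (hinj.mono hsub)
  have hp := UnitAddCircle.measurePreserving_mk a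
  rw [← hp.measure_preimage hm.nullMeasurableSet, Measure.restrict_apply' measurableSet_Ioc]
  congr 1
  ext x
  constructor
  · rintro ⟨⟨y, hy, hxy⟩, hx⟩
    rwa [← hinj (hsub hy) hx hxy]
  · intro hx
    exact ⟨⟨x, hx, rfl⟩, hsub hx⟩

lemma step_aux (T : UnitAddCircle → UnitAddCircle)
    (F : ℝ → ℝ) (KF : NNReal) (hF : LipschitzWith KF F) (hFmono : Monotone F)
    (hlift : ∀ x : ℝ, T (x : UnitAddCircle) = ((F x : ℝ) : UnitAddCircle))
    (hsurj : Function.Surjective T)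
    (V : Set UnitAddCircle) (lam : ℝ) (hlam0 : 0 < lam)
    (hexp : ∀ᵐ x : ℝ, ((x : UnitAddCircle) ∉ V → lam⁻¹ ≤ |deriv F x|))
    (J : Set UnitAddCircle) (hJ : IsConnected J) (hT : T '' J ≠ univ) (hJV : J ∩ V = ∅) :
    volume J ≤ ENNReal.ofReal lam * volume (T '' J) := by
  obtain ⟨y, hy⟩ := (ne_univ_iff_exists_notMem _).1 hT
  obtain ⟨p, hp⟩ := hsurj y
  obtain ⟨p0, rfl⟩ := QuotientAddGroup.mk_surjective p
  have hpJ : ((p0 : ℝ) : UnitAddCircle) ∉ J := fun h => hy ⟨_, h, hp⟩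
  let e := AddCircle.openPartialHomeomorphCoe (1 : ℝ) p0
  have hJt : J ⊆ e.target := by
    intro x hx hx'
    apply hpJ
    have : x = ((p0 : ℝ) : UnitAddCircle) := hx'
    exact this ▸ hx
  set A : Set ℝ := e.symm '' J with hAdef
  have hAc : IsPreconnected A :=
    hJ.isPreconnected.image _ (e.continuousOn_symm.mono hJt)
  have hAo : A.OrdConnected := hAc.ordConnected
  have hAs : A ⊆ Ioo p0 (p0 + 1) := by
    rintro _ ⟨x, hx, rfl⟩
    exact e.map_target (hJt hx)
  have hAJ : (fun x : ℝ => (x : UnitAddCircle)) '' A = J := by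
    rw [hAdef, image_image]
    ext x
    constructor
    · rintro ⟨z, hz, rfl⟩
      have : ((e.symm z : ℝ) : UnitAddCircle) = z := e.right_inv (hJt hz)
      simpa only [this] using hz
    · intro hx
      exact ⟨x, hx, e.right_inv (hJt hx)⟩
  clear_value A
  have hFA : T '' J = (fun x : ℝ => (x : UnitAddCircle)) '' (F '' A) := by
    rw [← hAJ, image_image, image_image]
    exact image_congr fun x _ => hlift x
  have hFAc : IsPreconnected (F '' A) := hAc.image _ hF.continuous.continuousOn
  have hFAo : (F '' A).OrdConnected := hFAc.ordConnected
  obtain ⟨z0, hz0⟩ : A.Nonempty := hAdef ▸ hJ.nonempty.image _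
  -- the window containing `F '' A`
  have hnot : ∀ n : ℤ, F p0 + n ∉ F '' A := by
    rintro n ⟨x, hx, hxn⟩
    apply hy
    rw [hFA]
    refine ⟨F x, ⟨x, hx, rfl⟩, ?_⟩
    rw [← hp]
    change ((F x : ℝ) : UnitAddCircle) = T ((p0 : ℝ) : UnitAddCircle)
    rw [hlift, hxn]
    have : ((n : ℝ) : UnitAddCircle) = 0 := by
      rw [AddCircle.coe_eq_zero_iff]
      exact ⟨n, by simp⟩
    rw [AddCircle.coe_add, this, add_zero]
  set n : ℤ := ⌊F z0 - F p0⌋ with hn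
  have hwin : F '' A ⊆ Ioo (F p0 + n) (F p0 + n + 1) := by
    have h1 : F p0 + n ≤ F z0 := by linarith [Int.floor_le (F z0 - F p0)]
    have h2 : F z0 < F p0 + n + 1 := by linarith [Int.lt_floor_add_one (F z0 - F p0)]
    have hz : F z0 ∈ F '' A := ⟨z0, hz0, rfl⟩
    intro w hw
    constructor
    · by_contra hc
      exact hnot n (hFAo.out hw hz ⟨not_lt.1 hc, h1⟩)
    · by_contra hc
      refine hnot (n + 1) (hFAo.out hz hw ?_)
      push_cast
      exact ⟨by linarith, by linarith [not_lt.1 hc]⟩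
  rw [hFA, volume_coe_image _ _ hFAo hwin, ← hAJ, volume_coe_image _ _ hAo hAs]
  have hexpA : ∀ᵐ x : ℝ, x ∈ A → lam⁻¹ ≤ |deriv F x| := by
    filter_upwards [hexp] with x hx hxA
    refine hx fun hxV => ?_
    have : (x : UnitAddCircle) ∈ J ∩ V := ⟨hAJ ▸ ⟨x, hxA, rfl⟩, hxV⟩
    rw [hJV] at this
    exact this
  have hgrow : ∀ a ∈ A, ∀ b ∈ A, dist a b ≤ lam * dist (F a) (F b) := by
    have key : ∀ a ∈ A, ∀ b ∈ A, a ≤ b → b - a ≤ lam * (F b - F a) := by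
      intro a ha b hb hab
      have := growth_aux F KF hF hFmono _ A hAo hexpA ha hb hab
      rwa [inv_mul_le_iff₀ hlam0] at this
    intro a ha b hb
    rcases le_total a b with hab | hab
    · rw [dist_comm, dist_comm (F a), Real.dist_eq, Real.dist_eq,
        abs_of_nonneg (by linarith), abs_of_nonneg (by linarith [hFmono hab])]
      exact key a ha b hb hab
    · rw [Real.dist_eq, Real.dist_eq,
        abs_of_nonneg (by linarith), abs_of_nonneg (by linarith [hFmono hab])]
      exact key b hb a ha hab
  have hinj : InjOn F A := by
    intro a ha b hb hab
    have := hgrow a ha b hb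
    rw [hab, dist_self, mul_zero] at this
    exact dist_le_zero.1 this
  have hlip : LipschitzOnWith lam.toNNReal (Function.invFunOn F A) (F '' A) := by
    refine LipschitzOnWith.of_dist_le_mul ?_
    rintro _ ⟨a, ha, rfl⟩ _ ⟨b, hb, rfl⟩
    rw [hinj.leftInvOn_invFunOn ha, hinj.leftInvOn_invFunOn hb, Real.coe_toNNReal _ hlam0.le]
    exact hgrow a ha b hb
  have := hlip.hausdorffMeasure_image_le zero_le_one
  rw [hinj.leftInvOn_invFunOn.image_image, hausdorffMeasure_real, ENNReal.rpow_one] at this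
  exact this

/-- for a Lipschitz circle covering map expanding away from an
indifferent fixed point `c`, an arc whose first `l` images contain at least `r`
images avoiding the neighborhood `V` of `c` satisfies `|J| ≤ λ^r |T^l J|`. -/
theorem stmt13
    (T : UnitAddCircle → UnitAddCircle) (hTcont : Continuous T)
    (F : ℝ → ℝ) (KF : NNReal) (hF : LipschitzWith KF F) (hFmono : Monotone F)
    (d : ℤ) (hd : 2 ≤ |d|) (hdeg : ∀ x : ℝ, F (x + 1) = F x + d)
    (hlift : ∀ x : ℝ, T (x : UnitAddCircle) = ((F x : ℝ) : UnitAddCircle))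
    (c : UnitAddCircle) (hc : T c = c)
    (V : Set UnitAddCircle) (hV : IsOpen V) (hcV : c ∈ V)
    (lam : ℝ) (hlam0 : 0 < lam) (hlam1 : lam < 1)
    -- `|T'| ≥ 1` Lebesgue-a.e.
    (hone : ∀ᵐ x : ℝ, 1 ≤ |deriv F x|)
    -- `|T'| ≥ λ⁻¹` Lebesgue-a.e. off `V`
    (hexp : ∀ᵐ x : ℝ, ((x : UnitAddCircle) ∉ V → lam⁻¹ ≤ |deriv F x|)) :
    ∀ J : Set UnitAddCircle, IsConnected J →
      ∀ l r : ℕ, 1 ≤ l → 1 ≤ r →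
        T^[l] '' J ≠ univ →
        r ≤ ((Finset.range l).filter (fun k => T^[k] '' J ∩ V = ∅)).card →
        volume J ≤ ENNReal.ofReal (lam ^ r) * volume (T^[l] '' J) := by
  intro J hJ l r hl hr hT hcard
  have hFsurj : Function.Surjective F := by
    have hg : ∀ a b : ℝ, a ≤ b → b - a ≤ F b - F a := by
      intro a b hab
      have := growth_aux F KF hF hFmono 1 univ ordConnected_univ
        (by filter_upwards [hone] with x hx _ using hx) (mem_univ a) (mem_univ b) hab
      linarith
    refine hF.continuous.surjective ?_ ?_
    · refine Filter.tendsto_atTop_mono' _ ?_ (Filter.tendsto_atTop_add_const_left _ (F 0) Filter.tendsto_id)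
      filter_upwards [Filter.eventually_ge_atTop 0] with x hx
      have := hg 0 x hx
      simp only [id]
      linarith
    · refine Filter.tendsto_atBot_mono' _ ?_ (Filter.tendsto_atBot_add_const_left _ (F 0) Filter.tendsto_id)
      filter_upwards [Filter.eventually_le_atBot 0] with x hx
      have := hg x 0 hx
      simp only [id]
      linarith
  have hsurj : Function.Surjective T := by
    intro y
    obtain ⟨y0, rfl⟩ := QuotientAddGroup.mk_surjective y
    obtain ⟨x, rfl⟩ := hFsurj y0
    exact ⟨(x : UnitAddCircle), hlift x⟩
  have main : ∀ m : ℕ, T^[m] '' J ≠ univ →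
      volume J ≤ ENNReal.ofReal
        (lam ^ ((Finset.range m).filter (fun k => T^[k] '' J ∩ V = ∅)).card) *
          volume (T^[m] '' J) := by
    intro m
    induction m with
    | zero => intro _; simp
    | succ m ih =>
      intro hm
      have himg : T^[m + 1] '' J = T '' (T^[m] '' J) := by
        rw [Function.iterate_succ', image_comp]
      have hm' : T^[m] '' J ≠ univ := by
        intro h
        apply hm
        rw [himg, h, image_univ, hsurj.range_eq]
      have hconn : IsConnected (T^[m] '' J) :=
        hJ.image _ (hTcont.iterate m).continuousOn
      have hTm : T '' (T^[m] '' J) ≠ univ := himg ▸ hm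
      refine (ih hm').trans ?_
      rw [Finset.range_add_one, Finset.filter_insert, himg]
      split_ifs with hV'
      · rw [Finset.card_insert_of_notMem (by simp), pow_succ,
          ENNReal.ofReal_mul (by positivity), mul_assoc]
        gcongr
        exact step_aux T F KF hF hFmono hlift hsurj V lam hlam0 hexp _ hconn hTm hV'
      · refine mul_le_mul_right ?_ _
        have := step_aux T F KF hF hFmono hlift hsurj ∅ 1 one_pos
          (by filter_upwards [hone] with x hx _; simpa using hx) _ hconn hTm (by simp)
        simpa using this
  refine (main l hT).trans ?_
  gcongr ENNReal.ofReal ?_ * _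
  exact pow_le_pow_of_le_one hlam0.le hlam1.le hcard
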